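/- Let M be an invertible 4×4 matrix with real entries and suppose the set S(M) = {(t₁, t₂, s₁, s₂) ∈ ℂ⁴ : F(t₁, t₂, s₁, s₂; M) = 0, t₁ ≠ t₂, s₁ ≠ s₂} has exactly 40 elements. Then the number of elements (t₁, t₂, s₁, s₂) of S(M) for which the subspace span{v(t₁), v(t₂)} ⊆ ℂ⁴ is stable under coordinatewise complex conjugation is divisible by 8; equivalently, the number of common real secant lines is even. -/

import Mathlib

open Matrix

noncomputable section

/-- `v(a) = (1, a, a², a³) ∈ ℂ⁴`. -/
def tcv (a : ℂ) : Fin 4 → ℂ := ![1, a, a ^ 2, a ^ 3]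

/-- `pᵢ(s; M)`, the `i`-th coordinate of `M·v(s)`. -/
def pc (M : Matrix (Fin 4) (Fin 4) ℂ) (i : Fin 4) (s : ℂ) : ℂ := M.mulVec (tcv s) i

/-- `f₁(t₁, t₂, s; M) = p₃(s; M) − (t₁ + t₂)p₂(s; M) + t₁t₂p₁(s; M)`. -/
def f₁ (M : Matrix (Fin 4) (Fin 4) ℂ) (t₁ t₂ s : ℂ) : ℂ :=
  pc M 2 s - (t₁ + t₂) * pc M 1 s + t₁ * t₂ * pc M 0 s

/-- `f₂(t₁, t₂, s; M) = p₄(s; M) − (t₁ + t₂)p₃(s; M) + t₁t₂p₂(s; M)`. -/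
def f₂ (M : Matrix (Fin 4) (Fin 4) ℂ) (t₁ t₂ s : ℂ) : ℂ :=
  pc M 3 s - (t₁ + t₂) * pc M 2 s + t₁ * t₂ * pc M 1 s

/-- The square polynomial system `F(·; M)` viewed as a map `ℂ⁴ → ℂ⁴`, with the
variables ordered `(t₁, t₂, s₁, s₂)`. -/
def Fmap (M : Matrix (Fin 4) (Fin 4) ℂ) (x : Fin 4 → ℂ) : Fin 4 → ℂ :=
  ![f₁ M (x 0) (x 1) (x 2), f₁ M (x 0) (x 1) (x 3),
    f₂ M (x 0) (x 1) (x 2), f₂ M (x 0) (x 1) (x 3)]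

/-- `S(M)`: solutions of `F(·; M) = 0` with `t₁ ≠ t₂` and `s₁ ≠ s₂`. -/
def Ssol (M : Matrix (Fin 4) (Fin 4) ℂ) : Set (Fin 4 → ℂ) :=
  {x | Fmap M x = 0 ∧ x 0 ≠ x 1 ∧ x 2 ≠ x 3}

/-- The 4×4 Jacobian matrix of `F(·; M)` with respect to `(t₁, t₂, s₁, s₂)`. -/
def Jac (M : Matrix (Fin 4) (Fin 4) ℂ) (x : Fin 4 → ℂ) : Matrix (Fin 4) (Fin 4) ℂ :=
  fun i j => deriv (fun z => Fmap M (Function.update x j z) i) (x j)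

/-- A real matrix viewed as a complex matrix. -/
def cm (M : Matrix (Fin 4) (Fin 4) ℝ) : Matrix (Fin 4) (Fin 4) ℂ :=
  M.map Complex.ofReal

/-- A subspace `L ⊆ ℂ⁴` is conjugation-stable if the coordinatewise complex conjugate of
every vector of `L` lies in `L`. -/
def ConjStable (L : Submodule ℂ (Fin 4 → ℂ)) : Prop :=
  ∀ w ∈ L, (fun i => (starRingEnd ℂ) (w i)) ∈ L

/-- A finite set on which three commuting involutions generate a free action of `(ℤ/2)³` has
cardinality divisible by `8`. -/
theorem eight_dvd_card_of_commuting_involutions {α : Type*} (A : Finset α) (a b c : α → α)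
    (ha : ∀ x, a (a x) = x) (hb : ∀ x, b (b x) = x) (hc : ∀ x, c (c x) = x)
    (hab : ∀ x, a (b x) = b (a x)) (hac : ∀ x, a (c x) = c (a x))
    (hbc : ∀ x, b (c x) = c (b x))
    (hA : ∀ x ∈ A, a x ∈ A) (hB : ∀ x ∈ A, b x ∈ A) (hC : ∀ x ∈ A, c x ∈ A)
    (na : ∀ x ∈ A, a x ≠ x) (nb : ∀ x ∈ A, b x ≠ x) (nab : ∀ x ∈ A, a (b x) ≠ x)
    (nc : ∀ x ∈ A, c x ≠ x) (nac : ∀ x ∈ A, a (c x) ≠ x) (nbc : ∀ x ∈ A, b (c x) ≠ x)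
    (nabc : ∀ x ∈ A, a (b (c x)) ≠ x) : 8 ∣ A.card := by
  classical
  let orb : α → Finset α := fun x =>
    {x, a x, b x, a (b x), c x, a (c x), b (c x), a (b (c x))}
  have self_mem : ∀ x, x ∈ orb x := fun x => by simp [orb]
  have orb_a : ∀ x, orb (a x) = orb x := fun x => by
    ext y; simp only [orb, Finset.mem_insert, Finset.mem_singleton]; grind
  have orb_b : ∀ x, orb (b x) = orb x := fun x => by
    ext y; simp only [orb, Finset.mem_insert, Finset.mem_singleton]; grind
  have orb_c : ∀ x, orb (c x) = orb x := fun x => by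
    ext y; simp only [orb, Finset.mem_insert, Finset.mem_singleton]; grind
  have orb_eq : ∀ x, ∀ y ∈ orb x, orb y = orb x := fun x y hy => by
    simp only [orb, Finset.mem_insert, Finset.mem_singleton] at hy
    rcases hy with rfl | rfl | rfl | rfl | rfl | rfl | rfl | rfl <;>
      grind
  have orb_sub : ∀ x ∈ A, orb x ⊆ A := fun x hx y hy => by
    simp only [orb, Finset.mem_insert, Finset.mem_singleton] at hy
    rcases hy with rfl | rfl | rfl | rfl | rfl | rfl | rfl | rfl <;>
      grind
  have card_orb : ∀ x ∈ A, (orb x).card = 8 := fun x hx => by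
    have := na x hx
    have := nb x hx
    have := nab x hx
    have := nc x hx
    have := nac x hx
    have := nbc x hx
    have := nabc x hx
    simp only [orb]
    repeat rw [Finset.card_insert_of_notMem
      (by simp only [Finset.mem_insert, Finset.mem_singleton]; grind)]
    simp
  rw [Finset.card_eq_sum_card_image orb A]
  refine Finset.dvd_sum fun o ho => ?_
  obtain ⟨x, hx, rfl⟩ := Finset.mem_image.1 ho
  have : A.filter (fun y => orb y = orb x) = orb x := by
    ext y
    rw [Finset.mem_filter]
    exact ⟨fun h => h.2 ▸ self_mem y, fun h => ⟨orb_sub x hx h, orb_eq x y h⟩⟩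
  rw [this, card_orb x hx]

theorem conj_tcv (a : ℂ) : (fun i => starRingEnd ℂ (tcv a i)) = tcv (starRingEnd ℂ a) := by
  ext i; fin_cases i <;> simp [tcv]

theorem conj_pc (M : Matrix (Fin 4) (Fin 4) ℝ) (i : Fin 4) (s : ℂ) :
    starRingEnd ℂ (pc (cm M) i s) = pc (cm M) i (starRingEnd ℂ s) := by
  simp [pc, cm, tcv, Matrix.mulVec, dotProduct, Fin.sum_univ_four]

theorem conj_f₁ (M : Matrix (Fin 4) (Fin 4) ℝ) (t₁ t₂ s : ℂ) :
    starRingEnd ℂ (f₁ (cm M) t₁ t₂ s) =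
      f₁ (cm M) (starRingEnd ℂ t₁) (starRingEnd ℂ t₂) (starRingEnd ℂ s) := by
  simp [f₁, conj_pc]

theorem conj_f₂ (M : Matrix (Fin 4) (Fin 4) ℝ) (t₁ t₂ s : ℂ) :
    starRingEnd ℂ (f₂ (cm M) t₁ t₂ s) =
      f₂ (cm M) (starRingEnd ℂ t₁) (starRingEnd ℂ t₂) (starRingEnd ℂ s) := by
  simp [f₂, conj_pc]

theorem f₁_swap (M : Matrix (Fin 4) (Fin 4) ℂ) (t₁ t₂ s : ℂ) : f₁ M t₁ t₂ s = f₁ M t₂ t₁ s := by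
  simp only [f₁]; ring

theorem f₂_swap (M : Matrix (Fin 4) (Fin 4) ℂ) (t₁ t₂ s : ℂ) : f₂ M t₁ t₂ s = f₂ M t₂ t₁ s := by
  simp only [f₂]; ring

theorem mem_Ssol {M : Matrix (Fin 4) (Fin 4) ℂ} {x : Fin 4 → ℂ} :
    x ∈ Ssol M ↔ (f₁ M (x 0) (x 1) (x 2) = 0 ∧ f₁ M (x 0) (x 1) (x 3) = 0 ∧
      f₂ M (x 0) (x 1) (x 2) = 0 ∧ f₂ M (x 0) (x 1) (x 3) = 0) ∧ x 0 ≠ x 1 ∧ x 2 ≠ x 3 := by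
  simp [Ssol, Fmap]

/-- Conjugates of vectors in `span {v(a), v(b)}` lie in `span {v(conj a), v(conj b)}`. -/
theorem conj_mem_span {a b : ℂ} {w : Fin 4 → ℂ} (hw : w ∈ Submodule.span ℂ {tcv a, tcv b}) :
    (fun i => starRingEnd ℂ (w i)) ∈
      Submodule.span ℂ {tcv (starRingEnd ℂ a), tcv (starRingEnd ℂ b)} := by
  obtain ⟨p, q, rfl⟩ := Submodule.mem_span_pair.1 hw
  refine Submodule.mem_span_pair.2 ⟨starRingEnd ℂ p, starRingEnd ℂ q, ?_⟩
  rw [← conj_tcv, ← conj_tcv]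
  ext i
  simp

theorem conjStable_of_conj {a b : ℂ}
    (h : ConjStable (Submodule.span ℂ {tcv (starRingEnd ℂ a), tcv (starRingEnd ℂ b)})) :
    ConjStable (Submodule.span ℂ {tcv a, tcv b}) := fun w hw => by
  simpa using conj_mem_span (h _ (conj_mem_span hw))

theorem conjStable_of_pair_eq {a b : ℂ}
    (h : ({tcv (starRingEnd ℂ a), tcv (starRingEnd ℂ b)} : Set (Fin 4 → ℂ)) = {tcv a, tcv b}) :
    ConjStable (Submodule.span ℂ {tcv a, tcv b}) := fun _ hw => h ▸ conj_mem_span hw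

/-- If `M` is an invertible real matrix and `S(M)` has exactly 40 elements, then the
number of elements `(t₁, t₂, s₁, s₂) ∈ S(M)` whose line `span{v(t₁), v(t₂)}` is
conjugation-stable is divisible by 8; equivalently, the number of common real secant
lines is even. -/
theorem real_solutions_div_eight (M : Matrix (Fin 4) (Fin 4) ℝ) (hM : IsUnit M.det)
    (h40 : (Ssol (cm M)).ncard = 40) :
    8 ∣ {x ∈ Ssol (cm M) |
      ConjStable (Submodule.span ℂ ({tcv (x 0), tcv (x 1)} : Set (Fin 4 → ℂ)))}.ncard := by
  have hfin : (Ssol (cm M)).Finite := Set.finite_of_ncard_pos (by omega)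
  set L : (Fin 4 → ℂ) → Prop := fun x =>
    ConjStable (Submodule.span ℂ ({tcv (x 0), tcv (x 1)} : Set (Fin 4 → ℂ))) with hL
  change 8 ∣ {x ∈ Ssol (cm M) | L x}.ncard
  have hsplit : {x ∈ Ssol (cm M) | L x}.ncard + {x ∈ Ssol (cm M) | ¬ L x}.ncard = 40 := by
    rw [← h40, ← Set.ncard_union_eq _ (hfin.subset fun x hx => hx.1) (hfin.subset fun x hx => hx.1)]
    · congr 1
      ext x
      simp only [Set.mem_union, Set.mem_ofPred_eq]
      tauto
    · exact Set.disjoint_left.2 fun x hx hx' => hx'.2 hx.2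
  suffices h : 8 ∣ {x ∈ Ssol (cm M) | ¬ L x}.ncard by omega
  have hNfin : {x ∈ Ssol (cm M) | ¬ L x}.Finite := hfin.subset fun x hx => hx.1
  rw [Set.ncard_eq_toFinset_card _ hNfin]
  have mem {x : Fin 4 → ℂ} : x ∈ hNfin.toFinset ↔ x ∈ Ssol (cm M) ∧ ¬ L x := by simp
  have vec (x : Fin 4 → ℂ) : ![x 0, x 1, x 2, x 3] = x := by
    ext i; fin_cases i <;> rfl
  have real_of_swap {x : Fin 4 → ℂ} (h₀ : starRingEnd ℂ (x 1) = x 0)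
      (h₁ : starRingEnd ℂ (x 0) = x 1) : L x :=
    conjStable_of_pair_eq (by rw [h₀, h₁, Set.pair_comm])
  have real_of_fix {x : Fin 4 → ℂ} (h₀ : starRingEnd ℂ (x 0) = x 0)
      (h₁ : starRingEnd ℂ (x 1) = x 1) : L x :=
    conjStable_of_pair_eq (by rw [h₀, h₁])
  refine eight_dvd_card_of_commuting_involutions hNfin.toFinset
    (fun x => ![x 1, x 0, x 2, x 3]) (fun x => ![x 0, x 1, x 3, x 2])
    (fun x i => starRingEnd ℂ (x i)) (fun x => by simp [vec]) (fun x => by simp [vec])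
    (fun x => by simp) (fun x => by simp) ?_ ?_ ?_ ?_ ?_ ?_ ?_ ?_ ?_ ?_ ?_ ?_
  · intro x; ext i; fin_cases i <;> rfl
  · intro x; ext i; fin_cases i <;> rfl
  · intro x hx
    obtain ⟨h, hl⟩ := mem.1 hx
    rw [mem_Ssol] at h
    refine mem.2 ⟨?_, ?_⟩
    · rw [mem_Ssol]
      simpa [f₁_swap _ (x 1), f₂_swap _ (x 1), ne_comm] using h
    · simpa [hL, Set.pair_comm] using hl
  · intro x hx
    obtain ⟨h, hl⟩ := mem.1 hx
    rw [mem_Ssol] at h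
    refine mem.2 ⟨?_, by simpa [hL] using hl⟩
    rw [mem_Ssol]
    exact ⟨⟨h.1.2.1, h.1.1, h.1.2.2.2, h.1.2.2.1⟩, h.2.1, h.2.2.symm⟩
  · intro x hx
    obtain ⟨h, hl⟩ := mem.1 hx
    refine mem.2 ⟨?_, fun h' => hl (conjStable_of_conj h')⟩
    rw [mem_Ssol] at h ⊢
    simpa [← conj_f₁, ← conj_f₂, (starRingEnd ℂ).injective.eq_iff] using h
  · intro x hx e
    exact (mem_Ssol.1 (mem.1 hx).1).2.1 (congrFun e 1)
  · intro x hx e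
    exact (mem_Ssol.1 (mem.1 hx).1).2.2 (congrFun e 3)
  · intro x hx e
    exact (mem_Ssol.1 (mem.1 hx).1).2.1 (congrFun e 1)
  · intro x hx e
    exact (mem.1 hx).2 (real_of_fix (congrFun e 0) (congrFun e 1))
  · intro x hx e
    exact (mem.1 hx).2 (real_of_swap (congrFun e 0) (congrFun e 1))
  · intro x hx e
    exact (mem.1 hx).2 (real_of_fix (congrFun e 0) (congrFun e 1))
  · intro x hx e
    exact (mem.1 hx).2 (real_of_swap (congrFun e 0) (congrFun e 1))
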